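/- Assume the Riemann hypothesis, i.e. every zero s of the Riemann zeta function with 0 < Re(s) < 1 satisfies Re(s) = 1/2. Then there exists a constant C > 0 such that for every real x ≥ e^{2e} and every real α with 10 ≤ α ≤ e^x, one has ∑_{p ≤ x} cos(α log p)/p ≤ log log log α + C, where the sum runs over primes p ≤ x. -/

import Mathlib

open Complex Filter Topology Metric

lemma norm_natCast_cpow_neg_sub_le {s : ℂ} (hs : 0 < s.re) {n : ℕ} (hn : 0 < n) {u : ℝ}
    (hu : u ∈ Set.Icc (n : ℝ) (n + 1)) :
    ‖(u : ℂ) ^ (-s) - (n : ℂ) ^ (-s)‖ ≤ ‖s‖ * (n : ℝ) ^ (-s.re - 1) := by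
  have hn' : (0 : ℝ) < n := by exact_mod_cast hn
  have hs0 : s ≠ 0 := fun h => by simp [h] at hs
  have key := norm_image_sub_le_of_norm_deriv_le_segment' (f := fun u : ℝ => (u : ℂ) ^ (-s))
    (f' := fun u : ℝ => (-s) * (u : ℂ) ^ (-s - 1)) (a := n) (b := n + 1)
    (C := ‖s‖ * (n : ℝ) ^ (-s.re - 1)) ?_ ?_ u hu
  · refine key.trans ?_
    have : u - n ≤ 1 := by linarith [hu.2]
    exact mul_le_of_le_one_right (by positivity) this
  · intro v hv
    have hv0 : 0 < v := hn'.trans_le hv.1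
    exact (hasDerivAt_ofReal_cpow_const hv0.ne' (neg_ne_zero.2 hs0)).hasDerivWithinAt
  · intro v hv
    have hv0 : 0 < v := hn'.trans_le hv.1
    rw [norm_mul, norm_neg, norm_cpow_eq_rpow_re_of_pos hv0]
    gcongr ?_ * ?_
    simp only [sub_re, neg_re, one_re]
    exact Real.rpow_le_rpow_of_nonpos hn' hv.1 (by linarith)

lemma norm_zeta_term_le {s : ℂ} (hs : 0 < s.re) {n : ℕ} (hn : 0 < n) :
    ‖(s - 1) * (n : ℂ) ^ (-s) - ((n : ℂ) ^ (1 - s) - (n + 1 : ℂ) ^ (1 - s))‖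
      ≤ ‖s - 1‖ * ‖s‖ * (n : ℝ) ^ (-s.re - 1) := by
  have hn' : (0 : ℝ) < n := by exact_mod_cast hn
  rcases eq_or_ne s 1 with rfl | hs1
  · simp
  have key := norm_image_sub_le_of_norm_deriv_le_segment'
    (f := fun u : ℝ => (u : ℂ) ^ (1 - s) + (s - 1) * (n : ℂ) ^ (-s) * u)
    (f' := fun u : ℝ => (1 - s) * (u : ℂ) ^ (1 - s - 1) + (s - 1) * (n : ℂ) ^ (-s) * 1)
    (a := n) (b := n + 1)
    (C := ‖s - 1‖ * ‖s‖ * (n : ℝ) ^ (-s.re - 1)) ?_ ?_ (n + 1) (by simp)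
  · rw [add_sub_cancel_left, mul_one] at key
    refine le_of_eq_of_le (congrArg _ ?_) key
    push_cast
    ring
  · intro v hv
    have hv0 : 0 < v := hn'.trans_le hv.1
    refine HasDerivAt.hasDerivWithinAt (HasDerivAt.add ?_ ?_)
    · exact hasDerivAt_ofReal_cpow_const hv0.ne' (sub_ne_zero.2 hs1.symm)
    · exact (HasDerivAt.ofReal_comp (hasDerivAt_id v)).const_mul _
  · intro v hv
    have h1 : (1 - s) * (v : ℂ) ^ (1 - s - 1) + (s - 1) * (n : ℂ) ^ (-s) * 1
        = (1 - s) * ((v : ℂ) ^ (-s) - (n : ℂ) ^ (-s)) := by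
      rw [show 1 - s - 1 = -s by ring]; ring
    rw [h1, norm_mul, norm_sub_rev, mul_assoc]
    gcongr
    exact norm_natCast_cpow_neg_sub_le hs hn ⟨hv.1, hv.2.le⟩

lemma summable_natCast_succ_rpow {a : ℝ} (ha : a < -1) :
    Summable fun n : ℕ => ((n + 1 : ℕ) : ℝ) ^ a :=
  (summable_nat_add_iff 1).2 (Real.summable_nat_rpow.2 ha)

lemma norm_zeta_term_le_of_half_lt_re {s : ℂ} (hs : 1 / 2 < s.re) (n : ℕ) :
    ‖(s - 1) * ((n + 1 : ℕ) : ℂ) ^ (-s) -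
      (((n + 1 : ℕ) : ℂ) ^ (1 - s) - (((n + 1 : ℕ) : ℂ) + 1) ^ (1 - s))‖
      ≤ ‖s - 1‖ * ‖s‖ * ((n + 1 : ℕ) : ℝ) ^ (-3 / 2 : ℝ) := by
  refine (norm_zeta_term_le (by linarith) n.succ_pos).trans ?_
  gcongr
  · simp
  · linarith

lemma hasSum_zeta_term_of_one_lt_re {s : ℂ} (hs : 1 < s.re) :
    HasSum (fun n : ℕ => (s - 1) * ((n + 1 : ℕ) : ℂ) ^ (-s) -
      (((n + 1 : ℕ) : ℂ) ^ (1 - s) - (((n + 1 : ℕ) : ℂ) + 1) ^ (1 - s))) (riemannZeta₁ s - 1) := by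
  have hs1 : s ≠ 1 := fun h => by simp [h] at hs
  have h1 : HasSum (fun n : ℕ => (s - 1) * ((n + 1 : ℕ) : ℂ) ^ (-s)) (riemannZeta₁ s) := by
    have : riemannZeta₁ s = (s - 1) * riemannZeta s := by
      rw [riemannZeta_eq_inv_sub_mul hs1, mul_inv_cancel_left₀ (sub_ne_zero.2 hs1)]
    rw [this, zeta_eq_tsum_one_div_nat_add_one_cpow hs]
    refine HasSum.mul_left _ ?_
    have := ((summable_nat_add_iff 1).2 (Complex.summable_one_div_nat_cpow.2 hs)).hasSum
    simpa [cpow_neg] using this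
  have h2 : Summable (fun n : ℕ => (s - 1) * ((n + 1 : ℕ) : ℂ) ^ (-s) -
      (((n + 1 : ℕ) : ℂ) ^ (1 - s) - (((n + 1 : ℕ) : ℂ) + 1) ^ (1 - s))) :=
    Summable.of_norm_bounded ((summable_natCast_succ_rpow (by norm_num)).mul_left _)
      (norm_zeta_term_le_of_half_lt_re (by linarith))
  have h3 : Summable (fun n : ℕ =>
      (((n + 1 : ℕ) : ℂ) ^ (1 - s) - (((n + 1 : ℕ) : ℂ) + 1) ^ (1 - s))) := by
    simpa using h1.summable.sub h2
  have h4 : Tendsto (fun n : ℕ => ((n + 1 : ℕ) : ℂ) ^ (1 - s)) atTop (𝓝 0) := by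
    rw [tendsto_zero_iff_norm_tendsto_zero]
    have h5 : Tendsto (fun n : ℕ => ((n + 1 : ℕ) : ℝ) ^ (-(s.re - 1))) atTop (𝓝 0) :=
      (tendsto_rpow_neg_atTop (by linarith)).comp
        (tendsto_natCast_atTop_atTop.comp (tendsto_add_atTop_nat 1))
    refine h5.congr fun n => ?_
    rw [norm_natCast_cpow_of_pos n.succ_pos]
    simp
  have h6 : HasSum (fun n : ℕ =>
      (((n + 1 : ℕ) : ℂ) ^ (1 - s) - (((n + 1 : ℕ) : ℂ) + 1) ^ (1 - s))) 1 := by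
    refine (h3.hasSum_iff_tendsto_nat).2 ?_
    have h7 : Tendsto (fun n : ℕ => 1 - ((n + 1 : ℕ) : ℂ) ^ (1 - s)) atTop (𝓝 (1 - 0)) :=
      h4.const_sub 1
    rw [sub_zero] at h7
    refine h7.congr fun n => ?_
    have := Finset.sum_range_sub' (fun n : ℕ => ((n + 1 : ℕ) : ℂ) ^ (1 - s)) n
    simp only [zero_add, Nat.cast_one, one_cpow] at this
    rw [← this]
    push_cast
    rfl
  exact h1.sub h6

lemma hasSum_zeta_term {s : ℂ} (hs : 1 / 2 < s.re) :
    HasSum (fun n : ℕ => (s - 1) * ((n + 1 : ℕ) : ℂ) ^ (-s) -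
      (((n + 1 : ℕ) : ℂ) ^ (1 - s) - (((n + 1 : ℕ) : ℂ) + 1) ^ (1 - s))) (riemannZeta₁ s - 1) := by
  set F : ℕ → ℂ → ℂ := fun n s => (s - 1) * ((n + 1 : ℕ) : ℂ) ^ (-s) -
      (((n + 1 : ℕ) : ℂ) ^ (1 - s) - (((n + 1 : ℕ) : ℂ) + 1) ^ (1 - s)) with hF
  have hsum : Summable fun n => F n s :=
    Summable.of_norm_bounded ((summable_natCast_succ_rpow (by norm_num)).mul_left _)
      (norm_zeta_term_le_of_half_lt_re hs)
  set R := ‖s‖ + 3 with hR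
  set U : Set ℂ := {z | 1 / 2 < z.re} ∩ ball 0 R with hU
  have hUo : IsOpen U := (isOpen_lt continuous_const continuous_re).inter isOpen_ball
  have hUc : IsPreconnected U :=
    ((convex_halfSpace_re_gt _).inter (convex_ball _ _)).isPreconnected
  have h1 : DifferentiableOn ℂ (fun z => ∑' n, F n z) U := by
    refine differentiableOn_tsum_of_summable_norm
      (u := fun n => (R + 1) * R * ((n + 1 : ℕ) : ℝ) ^ (-3 / 2 : ℝ))
      ((summable_natCast_succ_rpow (by norm_num)).mul_left _) ?_ hUo ?_
    · intro n
      have hn : ((n + 1 : ℕ) : ℂ) ≠ 0 := by exact_mod_cast n.succ_ne_zero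
      have hn' : ((n + 1 : ℕ) : ℂ) + 1 ≠ 0 := by exact_mod_cast (n + 1).succ_ne_zero
      intro z _
      refine DifferentiableAt.differentiableWithinAt ?_
      refine DifferentiableAt.sub (DifferentiableAt.mul (by fun_prop) ?_) (DifferentiableAt.sub ?_ ?_)
      · exact DifferentiableAt.const_cpow (by fun_prop) (Or.inl hn)
      · exact DifferentiableAt.const_cpow (by fun_prop) (Or.inl hn)
      · exact DifferentiableAt.const_cpow (by fun_prop) (Or.inl hn')
    · intro n z hz
      have hzR : ‖z‖ ≤ R := by simpa using (mem_ball_zero_iff.1 hz.2).le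
      refine (norm_zeta_term_le_of_half_lt_re hz.1 n).trans ?_
      gcongr
      exact (norm_sub_le z 1).trans (by simpa using hzR)
  have h2 : DifferentiableOn ℂ (fun z => riemannZeta₁ z - 1) U := by fun_prop
  have h0 : (2 : ℂ) ∈ U := by
    refine ⟨by simp; norm_num, ?_⟩
    rw [mem_ball_zero_iff, hR]
    norm_num
    linarith [norm_nonneg s]
  have hev : (fun z => ∑' n, F n z) =ᶠ[𝓝 2] fun z => riemannZeta₁ z - 1 := by
    have : {z : ℂ | 1 < z.re} ∈ 𝓝 (2 : ℂ) :=
      (isOpen_lt continuous_const continuous_re).mem_nhds (by simp)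
    filter_upwards [this] with z hz
    exact (hasSum_zeta_term_of_one_lt_re hz).tsum_eq
  have := (h1.analyticOnNhd hUo).eqOn_of_preconnected_of_eventuallyEq (h2.analyticOnNhd hUo) hUc h0
    hev (x := s) ⟨hs, by rw [mem_ball_zero_iff, hR]; linarith⟩
  exact (show ∑' n, F n s = riemannZeta₁ s - 1 from this) ▸ hsum.hasSum

lemma exists_norm_riemannZeta_le :
    ∃ K : ℝ, 0 < K ∧ ∀ s : ℂ, 1 / 2 < s.re → 1 ≤ ‖s - 1‖ → ‖riemannZeta s‖ ≤ 1 + K * ‖s‖ := by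
  have hsum := summable_natCast_succ_rpow (a := -3 / 2) (by norm_num)
  refine ⟨∑' n : ℕ, ((n + 1 : ℕ) : ℝ) ^ (-3 / 2 : ℝ),
    hsum.tsum_pos (fun n => by positivity) 0 (by simp), fun s hs hs1 => ?_⟩
  have hne : s ≠ 1 := fun h => by norm_num [h] at hs1
  have h1 : ‖riemannZeta₁ s - 1‖ ≤ ‖s - 1‖ * ‖s‖ * ∑' n : ℕ, ((n + 1 : ℕ) : ℝ) ^ (-3 / 2 : ℝ) := by
    rw [← (hasSum_zeta_term hs).tsum_eq]
    exact tsum_of_norm_bounded (hsum.hasSum.mul_left _) (norm_zeta_term_le_of_half_lt_re hs)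
  have h2 : ‖riemannZeta₁ s‖ ≤ ‖riemannZeta₁ s - 1‖ + 1 := by
    simpa using norm_add_le (riemannZeta₁ s - 1) 1
  rw [riemannZeta_eq_inv_sub_mul hne, norm_mul, norm_inv, inv_mul_le_iff₀ (by linarith)]
  nlinarith

lemma exists_log_on_ball {f : ℂ → ℂ} {c : ℂ} {R : ℝ} (hR : 0 < R)
    (hf : DifferentiableOn ℂ f (ball c R)) (h0 : ∀ z ∈ ball c R, f z ≠ 0) :
    ∃ F : ℂ → ℂ, F c = 0 ∧ (∀ z ∈ ball c R, HasDerivAt F (deriv f z / f z) z) ∧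
      ∀ z ∈ ball c R, f z = f c * exp (F z) := by
  have hc : c ∈ ball c R := mem_ball_self hR
  have hd : DifferentiableOn ℂ (fun z => deriv f z / f z) (ball c R) :=
    (hf.deriv isOpen_ball).div hf h0
  obtain ⟨G, hG⟩ := hd.isExactOn_ball
  have hF : ∀ z ∈ ball c R, HasDerivAt (fun z => G z - G c) (deriv f z / f z) z :=
    fun z hz => (hG z hz).sub_const _
  refine ⟨fun z => G z - G c, sub_self _, hF, fun z hz => ?_⟩
  have hconst : ∀ w ∈ ball c R, HasDerivAt (fun z => f z * exp (-(G z - G c))) 0 w := by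
    intro w hw
    have h1 := (hf.differentiableAt (isOpen_ball.mem_nhds hw)).hasDerivAt
    refine (h1.mul (hF w hw).neg.cexp).congr_deriv ?_
    field_simp [h0 w hw]
    ring
  have h2 := isOpen_ball.is_const_of_deriv_eq_zero (convex_ball c R).isPreconnected
    (fun w hw => (hconst w hw).differentiableAt.differentiableWithinAt)
    (fun w hw => (hconst w hw).deriv) hz hc
  simp only [sub_self, neg_zero, exp_zero, mul_one] at h2
  rw [← h2, mul_assoc, ← exp_add]
  simp

lemma norm_logDeriv_le_of_norm_le {f : ℂ → ℂ} {c : ℂ} {r R₁ R M : ℝ} (hr : 0 ≤ r) (hr1 : r < R₁)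
    (hR1 : R₁ < R) (hM : 0 < M)
    (hf : DifferentiableOn ℂ f (ball c R)) (h0 : ∀ z ∈ ball c R, f z ≠ 0)
    (hb : ∀ z ∈ ball c R, ‖f z‖ ≤ ‖f c‖ * Real.exp M) :
    ∀ z ∈ closedBall c r, ‖deriv f z / f z‖ ≤ 2 * M * R₁ / (R - R₁) / (R₁ - r) := by
  intro z hz
  have hRpos : 0 < R := by linarith
  have hR₁ : 0 ≤ R₁ := by linarith
  obtain ⟨F, hFc, hFd, hFe⟩ := exists_log_on_ball hRpos hf h0
  have hfc : 0 < ‖f c‖ := norm_pos_iff.2 (h0 c (mem_ball_self hRpos))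
  have hmem : ∀ w ∈ ball (0 : ℂ) R, c + w ∈ ball c R := fun w hw => by
    simpa [mem_ball, dist_eq_norm] using hw
  have hre : ∀ w ∈ ball c R, (F w).re ≤ M := by
    intro w hw
    have h1 := hb w hw
    rw [hFe w hw, norm_mul, norm_exp] at h1
    exact Real.exp_le_exp.1 (le_of_mul_le_mul_left h1 hfc)
  have hFb : ∀ w ∈ closedBall c R₁, ‖F w‖ ≤ 2 * M * R₁ / (R - R₁) := by
    intro w hw
    have hw' : ‖w - c‖ ≤ R₁ := by simpa [dist_eq_norm] using hw
    have h1 := borelCaratheodory_zero (f := fun w => F (c + w)) (R := R) (z := w - c) hM ?_ ?_ hRpos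
      ?_ (by simpa using hFc)
    · simp only [add_sub_cancel] at h1
      refine h1.trans ?_
      gcongr
    · intro v hv
      exact ((hFd _ (hmem v hv)).comp_const_add c v).differentiableAt.differentiableWithinAt
    · intro v hv
      exact hre _ (hmem v hv)
    · rw [mem_ball_zero_iff]; linarith
  have hz' : dist z c ≤ r := hz
  have hsub : closedBall z (R₁ - r) ⊆ closedBall c R₁ :=
    closedBall_subset_closedBall' (by linarith)
  have hsub' : closedBall c R₁ ⊆ ball c R := closedBall_subset_ball hR1
  have hzR : z ∈ ball c R := hsub' (hsub (mem_closedBall_self (by linarith)))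
  rw [← (hFd z hzR).deriv]
  refine norm_deriv_le_of_forall_mem_sphere_norm_le (by linarith) ?_ ?_
  · refine DifferentiableOn.diffContOnCl ?_
    rw [closure_ball _ (by linarith)]
    exact fun w hw => (hFd w (hsub' (hsub hw))).differentiableAt.differentiableWithinAt
  · exact fun w hw => hFb w (hsub (sphere_subset_closedBall hw))

/-- Hadamard's three circles theorem. -/
lemma norm_le_three_circles {f : ℂ → ℂ} {c : ℂ} {r₁ r₃ R a b : ℝ} (hr1 : 0 < r₁) (hr : r₁ < r₃)
    (hR : r₃ < R) (hf : DifferentiableOn ℂ f (ball c R))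
    (ha : ∀ z, ‖z - c‖ = r₁ → ‖f z‖ ≤ a) (hb : ∀ z, ‖z - c‖ = r₃ → ‖f z‖ ≤ b)
    {z : ℂ} (hz1 : r₁ ≤ ‖z - c‖) (hz3 : ‖z - c‖ ≤ r₃) :
    ‖f z‖ ≤ a ^ (1 - (Real.log ‖z - c‖ - Real.log r₁) / (Real.log r₃ - Real.log r₁)) *
      b ^ ((Real.log ‖z - c‖ - Real.log r₁) / (Real.log r₃ - Real.log r₁)) := by
  have hr3 : 0 < r₃ := hr1.trans hr
  have hzc : z - c ≠ 0 := norm_pos_iff.1 (hr1.trans_le hz1)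
  have hll : Real.log r₁ < Real.log r₃ := Real.log_lt_log hr1 hr
  have hnorm : ∀ w : ℂ, ‖c + exp w - c‖ = Real.exp w.re := fun w => by
    rw [add_sub_cancel_left, norm_exp]
  have hball : ∀ w : ℂ, w.re ≤ Real.log r₃ → c + exp w ∈ closedBall c r₃ := fun w hw => by
    rw [mem_closedBall, dist_eq_norm, hnorm, ← Real.le_log_iff_exp_le hr3]
    exact hw
  have hsub : closedBall c r₃ ⊆ ball c R := closedBall_subset_ball hR
  have hdiff : ∀ w : ℂ, w.re ≤ Real.log r₃ → DifferentiableAt ℂ (fun w => f (c + exp w)) w := by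
    intro w hw
    exact (hf.differentiableAt (isOpen_ball.mem_nhds (hsub (hball w hw)))).comp w (by fun_prop)
  have key := HadamardThreeLines.norm_le_interp_of_mem_verticalClosedStrip'
    (f := fun w => f (c + exp w)) (z := log (z - c)) (a := a) (b := b) hll ?_ ?_ ?_ ?_ ?_
  · simpa [exp_log hzc, log_re] using key
  · simp only [HadamardThreeLines.verticalClosedStrip, Set.mem_preimage, log_re]
    exact ⟨Real.log_le_log hr1 hz1, Real.log_le_log (hr1.trans_le hz1) hz3⟩
  · refine DifferentiableOn.diffContOnCl fun w hw => (hdiff w ?_).differentiableWithinAt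
    have h1 : closure (HadamardThreeLines.verticalStrip (Real.log r₁) (Real.log r₃)) ⊆
        re ⁻¹' Set.Iic (Real.log r₃) :=
      closure_minimal (fun v hv => (hv.2).le) (isClosed_Iic.preimage continuous_re)
    exact h1 hw
  · obtain ⟨B, hB⟩ := (isCompact_closedBall c r₃).exists_bound_of_continuousOn
      (hf.continuousOn.mono hsub)
    refine ⟨B, ?_⟩
    rintro _ ⟨w, hw, rfl⟩
    exact hB _ (hball w hw.2)
  · intro w hw
    exact ha _ (by rw [hnorm, show w.re = Real.log r₁ from hw, Real.exp_log hr1])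
  · intro w hw
    exact hb _ (by rw [hnorm, show w.re = Real.log r₃ from hw, Real.exp_log hr3])

lemma norm_LSeries_le_of_norm_le {f : ℕ → ℂ} {g : ℕ → ℝ} {s : ℂ} (h : ∀ n, ‖f n‖ ≤ g n)
    (hg : LSeriesSummable (fun n => (g n : ℂ)) s.re) :
    HasSum (fun n => ‖LSeries.term (fun n => (g n : ℂ)) s.re n‖)
        ‖LSeries (fun n => (g n : ℂ)) s.re‖ ∧
      ‖LSeries f s‖ ≤ ‖LSeries (fun n => (g n : ℂ)) s.re‖ := by
  have hg0 : ∀ n, 0 ≤ g n := fun n => (norm_nonneg _).trans (h n)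
  have hn : ∀ n, LSeries.term (fun n => (g n : ℂ)) s.re n =
      ((‖LSeries.term (fun n => (g n : ℂ)) s.re n‖ : ℝ) : ℂ) := by
    intro n
    rcases Nat.eq_zero_or_pos n with rfl | hn
    · simp
    · have h1 : (n : ℂ) ^ (s.re : ℂ) = (((n : ℝ) ^ s.re : ℝ) : ℂ) := by
        rw [ofReal_cpow (by positivity)]; simp
      rw [LSeries.norm_term_eq, if_neg hn.ne', LSeries.term_of_ne_zero hn.ne', h1]
      simp [abs_of_nonneg (hg0 n)]
  have h1 : HasSum (fun n => ‖LSeries.term (fun n => (g n : ℂ)) s.re n‖)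
      ‖LSeries (fun n => (g n : ℂ)) s.re‖ := by
    have h2 : Summable fun n => ‖LSeries.term (fun n => (g n : ℂ)) s.re n‖ := hg.norm
    convert h2.hasSum using 1
    rw [LSeries, tsum_congr hn, ← ofReal_tsum, norm_real, Real.norm_eq_abs,
      abs_of_nonneg (tsum_nonneg fun n => norm_nonneg _)]
  refine ⟨h1, tsum_of_norm_bounded h1 fun n => ?_⟩
  rw [LSeries.norm_term_eq, LSeries.norm_term_eq]
  split_ifs with hn
  · rfl
  · have : ‖f n‖ ≤ ‖(g n : ℂ)‖ := by
      rw [norm_real, Real.norm_eq_abs]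
      exact (h n).trans (le_abs_self _)
    simp only [ofReal_re]
    gcongr

lemma LSeriesSummable_ofReal_one {σ : ℝ} (hσ : 1 < σ) :
    LSeriesSummable (fun _ => ((1 : ℝ) : ℂ)) σ := by
  simp only [ofReal_one]
  exact LSeriesSummable_one_iff.2 (by simpa using hσ)

lemma LSeries_ofReal_one {σ : ℝ} (hσ : 1 < σ) :
    LSeries (fun _ => ((1 : ℝ) : ℂ)) σ = riemannZeta σ := by
  simp only [ofReal_one]
  exact LSeries_one_eq_riemannZeta (by simpa using hσ)

lemma norm_riemannZeta_le_re {s : ℂ} (hs : 1 < s.re) : ‖riemannZeta s‖ ≤ ‖riemannZeta s.re‖ := by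
  have := (norm_LSeries_le_of_norm_le (f := 1) (g := fun _ => 1) (by simp)
    (LSeriesSummable_ofReal_one hs)).2
  rwa [LSeries_ofReal_one hs, LSeries_one_eq_riemannZeta hs] at this

lemma one_le_norm_riemannZeta_mul {s : ℂ} (hs : 1 < s.re) :
    1 ≤ ‖riemannZeta s‖ * ‖riemannZeta s.re‖ := by
  have h1 := (norm_LSeries_le_of_norm_le (f := fun n => (ArithmeticFunction.moebius n : ℂ))
    (g := fun _ => 1) (fun n => by
      rw [norm_intCast]; exact_mod_cast ArithmeticFunction.abs_moebius_le_one)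
    (LSeriesSummable_ofReal_one hs)).2
  rw [LSeries_ofReal_one hs] at h1
  have h2 := ArithmeticFunction.LSeries_zeta_mul_Lseries_moebius hs
  rw [ArithmeticFunction.LSeries_zeta_eq_riemannZeta hs] at h2
  calc (1 : ℝ) = ‖riemannZeta s‖ * ‖LSeries (fun n => (ArithmeticFunction.moebius n : ℂ)) s‖ := by
        rw [← norm_mul, h2, norm_one]
    _ ≤ _ := by gcongr

lemma norm_logDeriv_riemannZeta_le_re {s : ℂ} (hs : 1 < s.re) :
    HasSum (fun n => ‖LSeries.term (fun n => ((ArithmeticFunction.vonMangoldt n : ℝ) : ℂ)) s.re n‖)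
        ‖deriv riemannZeta s.re / riemannZeta s.re‖ ∧
      ‖deriv riemannZeta s / riemannZeta s‖ ≤ ‖deriv riemannZeta s.re / riemannZeta s.re‖ := by
  have h := norm_LSeries_le_of_norm_le (s := s)
    (f := fun n => ((ArithmeticFunction.vonMangoldt n : ℝ) : ℂ))
    (g := fun n => ArithmeticFunction.vonMangoldt n) (fun n => by
      rw [norm_real, Real.norm_eq_abs, abs_of_nonneg ArithmeticFunction.vonMangoldt_nonneg])
    (ArithmeticFunction.LSeriesSummable_vonMangoldt (by simpa using hs))
  rw [ArithmeticFunction.LSeries_vonMangoldt_eq_deriv_riemannZeta_div hs,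
    ArithmeticFunction.LSeries_vonMangoldt_eq_deriv_riemannZeta_div (by simpa using hs),
    neg_div, neg_div, norm_neg, norm_neg] at h
  exact h

lemma exists_riemannZeta_bounds_near_one :
    ∃ A : ℝ, 2 ≤ A ∧ ∀ κ : ℝ, 0 < κ → κ ≤ 9 →
      ‖deriv riemannZeta ((1 + κ : ℝ) : ℂ) / riemannZeta ((1 + κ : ℝ) : ℂ)‖ ≤ A / κ ∧
      ‖riemannZeta ((1 + κ : ℝ) : ℂ)‖ ≤ A / κ := by
  have hre : ∀ κ : ℝ, 0 < κ → riemannZeta ((1 + κ : ℝ) : ℂ) ≠ 0 := fun κ hκ =>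
    riemannZeta_ne_zero_of_one_le_re (by simpa using hκ.le)
  have hne : ∀ κ : ℝ, 0 < κ → ((1 + κ : ℝ) : ℂ) ≠ 1 := fun κ hκ h => by
    have : (1 + κ : ℝ) = 1 := by exact_mod_cast h
    linarith
  have hζ₁ : ∀ κ : ℝ, 0 ≤ κ → riemannZeta₁ ((1 + κ : ℝ) : ℂ) ≠ 0 := by
    intro κ hκ
    rcases hκ.eq_or_lt with rfl | hκ
    · simp
    · intro h
      apply hre κ hκ
      rw [riemannZeta_eq_inv_sub_mul (hne κ hκ), h, mul_zero]
  have hcont : Continuous fun κ : ℝ => ((1 + κ : ℝ) : ℂ) := by fun_prop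
  obtain ⟨B₁, hB₁⟩ := (isCompact_Icc (a := (0 : ℝ)) (b := 9)).exists_bound_of_continuousOn
    (f := fun κ : ℝ => deriv riemannZeta₁ ((1 + κ : ℝ) : ℂ) / riemannZeta₁ ((1 + κ : ℝ) : ℂ))
    (ContinuousOn.div (differentiable_riemannZeta₁.deriv.continuous.comp hcont).continuousOn
      (differentiable_riemannZeta₁.continuous.comp hcont).continuousOn fun κ hκ => hζ₁ κ hκ.1)
  obtain ⟨B₂, hB₂⟩ := (isCompact_Icc (a := (0 : ℝ)) (b := 9)).exists_bound_of_continuousOn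
    (f := fun κ : ℝ => riemannZeta₁ ((1 + κ : ℝ) : ℂ))
    (differentiable_riemannZeta₁.continuous.comp hcont).continuousOn
  refine ⟨2 + 9 * |B₁| + |B₂|, by linarith [abs_nonneg B₁, abs_nonneg B₂], fun κ hκ hκ9 => ?_⟩
  have hinv : ‖(((1 + κ : ℝ) : ℂ) - 1)⁻¹‖ = κ⁻¹ := by
    simp [abs_of_pos hκ]
  constructor
  · have h1 : deriv riemannZeta ((1 + κ : ℝ) : ℂ) / riemannZeta ((1 + κ : ℝ) : ℂ) =
        -(((1 + κ : ℝ) : ℂ) - 1)⁻¹ +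
          deriv riemannZeta₁ ((1 + κ : ℝ) : ℂ) / riemannZeta₁ ((1 + κ : ℝ) : ℂ) := by
      have := hζ₁ κ hκ.le
      have := hne κ hκ
      grind [deriv_riemannZeta_eq_neg_inv_sub_sq_mul_add, riemannZeta_eq_inv_sub_mul]
    rw [h1]
    refine (norm_add_le _ _).trans ?_
    rw [norm_neg, hinv, le_div_iff₀ hκ, add_mul, inv_mul_cancel₀ hκ.ne']
    have h2 := (hB₁ κ ⟨hκ.le, hκ9⟩).trans (le_abs_self B₁)
    nlinarith [abs_nonneg B₁, abs_nonneg B₂, norm_nonneg (deriv riemannZeta₁ ((1 + κ : ℝ) : ℂ) /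
      riemannZeta₁ ((1 + κ : ℝ) : ℂ))]
  · rw [riemannZeta_eq_inv_sub_mul (hne κ hκ), norm_mul, hinv, inv_mul_eq_div]
    gcongr
    have h2 := (hB₂ κ ⟨hκ.le, hκ9⟩).trans (le_abs_self B₂)
    linarith [abs_nonneg B₁]

lemma re_im_of_mem_ball {t : ℝ} (ht : 10 ≤ t) {z : ℂ} (hz : z ∈ ball (5 + t * I : ℂ) (35 / 8)) :
    5 / 8 < z.re ∧ 1 ≤ z.im := by
  have hz' : ‖z - (5 + t * I)‖ < 35 / 8 := by simpa [dist_eq_norm] using hz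
  have h1 := (abs_re_le_norm _).trans_lt hz'
  have h2 := (abs_im_le_norm _).trans_lt hz'
  simp only [sub_re, add_re, re_ofNat, mul_re, ofReal_re, I_re, ofReal_im, I_im, mul_zero, mul_one,
    sub_self, add_zero, sub_im, add_im, im_ofNat, mul_im, zero_add, abs_lt] at h1 h2
  constructor <;> linarith [h1.1, h2.1]

lemma differentiableOn_riemannZeta_ball {t : ℝ} (ht : 10 ≤ t) :
    DifferentiableOn ℂ riemannZeta (ball (5 + t * I : ℂ) (35 / 8)) := by
  intro z hz
  refine (differentiableAt_riemannZeta ?_).differentiableWithinAt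
  rintro rfl
  have := (re_im_of_mem_ball ht hz).2
  norm_num at this

lemma exists_norm_logDeriv_riemannZeta_le_log (hz : ∀ s : ℂ, 1 / 2 < s.re → riemannZeta s ≠ 0) :
    ∃ B : ℝ, 1 ≤ B ∧ ∀ t : ℝ, 10 ≤ t → ∀ s ∈ closedBall (5 + t * I) (17 / 4),
      ‖deriv riemannZeta s / riemannZeta s‖ ≤ B * Real.log t := by
  obtain ⟨K, hK, hKb⟩ := exists_norm_riemannZeta_le
  obtain ⟨A, hA, hAb⟩ := exists_riemannZeta_bounds_near_one
  refine ⟨2208 * (1 + |Real.log ((1 + 2 * K) * A)|),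
    by linarith [abs_nonneg (Real.log ((1 + 2 * K) * A))], fun t ht s hs => ?_⟩
  have hlogt : 1 ≤ Real.log t := by
    rw [Real.le_log_iff_exp_le (by linarith)]
    linarith [Real.exp_one_lt_d9]
  set c : ℂ := 5 + t * I with hc
  have hcre : c.re = 5 := by simp [hc]
  have hre : ∀ z ∈ ball c (35 / 8), 5 / 8 < z.re := fun z hz => (re_im_of_mem_ball ht hz).1
  have hsub1 : ∀ z ∈ ball c (35 / 8), 1 ≤ ‖z - 1‖ := by
    intro z hz
    have h1 := abs_im_le_norm (z - 1)
    rw [sub_im, one_im, sub_zero] at h1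
    linarith [(re_im_of_mem_ball ht hz).2, le_abs_self z.im]
  set M := (1 + |Real.log ((1 + 2 * K) * A)|) * Real.log t with hM
  have hMpos : 0 < M := by positivity
  have key := norm_logDeriv_le_of_norm_le (f := riemannZeta) (c := c) (r := 17 / 4) (R₁ := 69 / 16)
    (R := 35 / 8) (M := M) (by norm_num) (by norm_num) (by norm_num) hMpos ?_ ?_ ?_ s hs
  · refine key.trans (le_of_eq ?_)
    rw [hM]
    ring
  · exact differentiableOn_riemannZeta_ball ht
  · exact fun z hz' => hz z (by linarith [hre z hz'])
  · intro z hz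
    have hzn : ‖z‖ ≤ 2 * t := by
      have h1 : ‖z - c‖ < 35 / 8 := by simpa [dist_eq_norm] using hz
      have h2 : ‖c‖ ≤ 5 + t := by
        refine (norm_add_le _ _).trans ?_
        simp [abs_of_nonneg (show (0 : ℝ) ≤ t by linarith)]
      have h3 := norm_add_le (z - c) c
      rw [sub_add_cancel] at h3
      linarith
    have h1 : ‖riemannZeta z‖ ≤ (1 + 2 * K) * t := by
      have := hKb z (by linarith [hre z hz]) (hsub1 z hz)
      nlinarith
    have h2 : 1 ≤ ‖riemannZeta c‖ * A := by
      have h3 := one_le_norm_riemannZeta_mul (s := c) (by rw [hcre]; norm_num)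
      have h4 := (hAb 4 (by norm_num) (by norm_num)).2
      rw [hcre] at h3
      norm_num at h3 h4
      refine h3.trans ?_
      gcongr
      linarith
    have h3 : (1 + 2 * K) * A * t ≤ Real.exp M := by
      have hp : 0 < (1 + 2 * K) * A := by positivity
      rw [← Real.log_le_iff_le_exp (by positivity), Real.log_mul hp.ne' (by linarith), hM]
      nlinarith [abs_nonneg (Real.log ((1 + 2 * K) * A)), le_abs_self (Real.log ((1 + 2 * K) * A))]
    calc ‖riemannZeta z‖ ≤ (1 + 2 * K) * t * 1 := by linarith
      _ ≤ (1 + 2 * K) * t * (‖riemannZeta c‖ * A) := by gcongr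
      _ = ‖riemannZeta c‖ * ((1 + 2 * K) * A * t) := by ring
      _ ≤ _ := by gcongr

lemma two_thirds_le_log_log {t : ℝ} (ht : 10 ≤ t) : 2 / 3 ≤ Real.log (Real.log t) := by
  have h1 : 2 ≤ Real.log t := by
    rw [Real.le_log_iff_exp_le (by linarith), show (2 : ℝ) = 1 + 1 by norm_num, Real.exp_add]
    nlinarith [Real.exp_one_lt_d9, Real.exp_pos 1]
  have h2 := Real.log_le_log (by norm_num) h1
  linarith [Real.log_two_gt_d9]

lemma exists_norm_logDeriv_riemannZeta_le_log_log
    (hz : ∀ s : ℂ, 1 / 2 < s.re → riemannZeta s ≠ 0) :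
    ∃ D : ℝ, 0 < D ∧ ∀ t : ℝ, 10 ≤ t → ∀ σ : ℝ, 1 ≤ σ → σ ≤ 1 + (Real.log (Real.log t))⁻¹ →
      ‖deriv riemannZeta (σ + t * I) / riemannZeta (σ + t * I)‖
        ≤ D * Real.log (Real.log t) := by
  obtain ⟨A, hA, hAb⟩ := exists_riemannZeta_bounds_near_one
  obtain ⟨B, hB, hBb⟩ := exists_norm_logDeriv_riemannZeta_le_log hz
  refine ⟨A * (B ^ (12 : ℝ) * Real.exp 7), by positivity, fun t ht σ hσ1 hσ2 => ?_⟩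
  have hL := two_thirds_le_log_log ht
  set L := Real.log (Real.log t) with hLdef
  have hL0 : 0 < L := by linarith
  have hη : L⁻¹ ≤ 3 / 2 := by
    rw [inv_le_comm₀ hL0 (by norm_num)]
    linarith
  have hη0 : 0 < L⁻¹ := by positivity
  have hlogt : 1 ≤ Real.log t := by
    rw [Real.le_log_iff_exp_le (by linarith)]
    linarith [Real.exp_one_lt_d9]
  set c : ℂ := 5 + t * I with hc
  have hcre : c.re = 5 := by simp [hc]
  have hnorm : ‖(σ + t * I : ℂ) - c‖ = 5 - σ := by
    rw [hc, add_sub_add_right_eq_sub, norm_sub_rev]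
    have : ((5 : ℂ) - σ) = ((5 - σ : ℝ) : ℂ) := by push_cast; rfl
    rw [this, norm_real, Real.norm_eq_abs, abs_of_nonneg (by linarith)]
  have key := norm_le_three_circles (f := fun z => deriv riemannZeta z / riemannZeta z) (c := c)
    (r₁ := 4 - L⁻¹) (r₃ := 17 / 4) (R := 35 / 8) (a := A * L) (b := B * Real.log t)
    (z := σ + t * I) (by linarith) (by linarith) (by norm_num) ?_ ?_ ?_
    (by rw [hnorm]; linarith) (by rw [hnorm]; linarith)
  · rw [hnorm] at key
    set θ := (Real.log (5 - σ) - Real.log (4 - L⁻¹)) / (Real.log (17 / 4) - Real.log (4 - L⁻¹))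
      with hθ
    have h1 : Real.log (4 - L⁻¹) ≤ Real.log (5 - σ) :=
      Real.log_le_log (by linarith) (by linarith)
    have h2 : Real.log (5 - σ) ≤ Real.log 4 := Real.log_le_log (by linarith) (by linarith)
    have h3 : 1 / 17 ≤ Real.log (17 / 4) - Real.log 4 := by
      rw [← Real.log_div (by norm_num) (by norm_num)]
      have := Real.one_sub_inv_le_log_of_pos (x := 17 / 4 / 4) (by norm_num)
      norm_num at this ⊢
      linarith
    have h4 : Real.log 4 - Real.log (4 - L⁻¹) ≤ L⁻¹ * (2 / 5) := by
      rw [← Real.log_div (by norm_num) (by linarith)]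
      refine (Real.log_le_sub_one_of_pos (div_pos (by norm_num) (by linarith))).trans ?_
      rw [div_sub_one (by linarith), div_le_iff₀ (by linarith)]
      nlinarith
    have hθ0 : 0 ≤ θ := div_nonneg (by linarith) (by linarith)
    have hθ1 : θ ≤ 7 * L⁻¹ := by
      rw [hθ, div_le_iff₀ (by linarith)]
      nlinarith
    have hAL : 1 ≤ A * L := by nlinarith
    refine key.trans ?_
    have e1 : (A * L) ^ (1 - θ) ≤ A * L := by
      simpa using Real.rpow_le_rpow_of_exponent_le hAL (show 1 - θ ≤ 1 by linarith)
    have e2 : B ^ θ ≤ B ^ (12 : ℝ) := Real.rpow_le_rpow_of_exponent_le hB (by linarith)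
    have e3 : Real.log t ^ θ ≤ Real.exp 7 := by
      rw [Real.rpow_def_of_pos (by linarith), ← hLdef]
      refine Real.exp_le_exp.2 ?_
      calc L * θ ≤ L * (7 * L⁻¹) := by gcongr
        _ = 7 := by field_simp
    calc (A * L) ^ (1 - θ) * (B * Real.log t) ^ θ
        = (A * L) ^ (1 - θ) * (B ^ θ * Real.log t ^ θ) := by
          rw [Real.mul_rpow (x := B) (by linarith) (by linarith)]
      _ ≤ (A * L) * (B ^ (12 : ℝ) * Real.exp 7) := by gcongr
      _ = _ := by ring
  · refine ((differentiableOn_riemannZeta_ball ht).deriv isOpen_ball).div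
      (differentiableOn_riemannZeta_ball ht) fun z hz' => hz z ?_
    linarith [(re_im_of_mem_ball ht hz').1]
  · intro z hzr
    have h1 := (abs_re_le_norm (z - c))
    rw [hzr, sub_re, hcre, abs_le] at h1
    have hlow : 1 + L⁻¹ ≤ z.re := by linarith [h1.1]
    have hκ := (hAb (z.re - 1) (by linarith) (by linarith [h1.2])).1
    rw [add_sub_cancel] at hκ
    refine (norm_logDeriv_riemannZeta_le_re (by linarith)).2.trans (hκ.trans ?_)
    rw [div_le_iff₀ (by linarith)]
    calc A = A * L * L⁻¹ := by field_simp
      _ ≤ A * L * (z.re - 1) := by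
        gcongr
        linarith
  · intro z hzr
    exact hBb t ht z (by simpa [dist_eq_norm] using hzr.le)

lemma exists_norm_riemannZeta_le_log_log (hz : ∀ s : ℂ, 1 / 2 < s.re → riemannZeta s ≠ 0) :
    ∃ C : ℝ, 0 < C ∧ ∀ t : ℝ, 10 ≤ t → ∀ σ : ℝ, 1 ≤ σ → σ ≤ 1 + (Real.log (Real.log t))⁻¹ →
      ‖riemannZeta (σ + t * I)‖ ≤ C * Real.log (Real.log t) := by
  obtain ⟨A, hA, hAb⟩ := exists_riemannZeta_bounds_near_one
  obtain ⟨D, hD, hDb⟩ := exists_norm_logDeriv_riemannZeta_le_log_log hz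
  refine ⟨A * Real.exp D, by positivity, fun t ht σ hσ1 hσ2 => ?_⟩
  have hL := two_thirds_le_log_log ht
  have hDt := hDb t ht
  set L := Real.log (Real.log t) with hLdef
  have hL0 : 0 < L := by linarith
  have hη : L⁻¹ ≤ 3 / 2 := by
    rw [inv_le_comm₀ hL0 (by norm_num)]
    linarith
  have hη0 : 0 < L⁻¹ := by positivity
  obtain ⟨F, -, hFd, hFe⟩ := exists_log_on_ball (by norm_num) (differentiableOn_riemannZeta_ball ht)
    fun z hz' => hz z (by linarith [(re_im_of_mem_ball ht hz').1])
  have hmem : ∀ u : ℝ, 1 ≤ u → u ≤ 1 + L⁻¹ → (u + t * I : ℂ) ∈ ball (5 + t * I : ℂ) (35 / 8) := by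
    intro u hu1 hu2
    have : ((u : ℂ) - 5) = ((u - 5 : ℝ) : ℂ) := by push_cast; rfl
    rw [mem_ball, dist_eq_norm, add_sub_add_right_eq_sub, this, norm_real, Real.norm_eq_abs, abs_lt]
    constructor <;> linarith
  have hdiff := norm_image_sub_le_of_norm_deriv_le_segment' (f := fun u : ℝ => F (u + t * I))
    (f' := fun u : ℝ => deriv riemannZeta (u + t * I) / riemannZeta (u + t * I))
    (a := σ) (b := 1 + L⁻¹) (C := D * L) ?_ ?_ (1 + L⁻¹) ⟨hσ2, le_rfl⟩
  · set s₁ : ℂ := ((1 + L⁻¹ : ℝ) : ℂ) + t * I with hs₁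
    set s₀ : ℂ := (σ : ℂ) + t * I with hs₀
    have h1 : ‖F s₁ - F s₀‖ ≤ D := by
      refine hdiff.trans ?_
      calc D * L * (1 + L⁻¹ - σ) ≤ D * L * L⁻¹ := by
            gcongr
            linarith
        _ = D := by field_simp
    have h2 : riemannZeta s₀ = riemannZeta s₁ * exp (F s₀ - F s₁) := by
      rw [hFe s₀ (hmem σ hσ1 hσ2), hFe s₁ (hmem _ (by linarith) le_rfl), mul_assoc, ← exp_add]
      simp
    have hre : s₁.re = 1 + L⁻¹ := by simp [hs₁]
    have h3 : ‖riemannZeta s₁‖ ≤ A * L := by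
      refine (norm_riemannZeta_le_re (by rw [hre]; linarith)).trans ?_
      rw [hre]
      simpa using (hAb L⁻¹ hη0 (by linarith)).2
    rw [h2, norm_mul, norm_exp]
    have h4 : (F s₀ - F s₁).re ≤ D :=
      (re_le_norm _).trans (by rwa [norm_sub_rev])
    calc ‖riemannZeta s₁‖ * Real.exp (F s₀ - F s₁).re ≤ A * L * Real.exp D := by gcongr
      _ = _ := by ring
  · intro u hu
    have h := (hFd (u + t * I) (hmem u (by linarith [hu.1]) hu.2)).comp_add_const (u : ℂ) (t * I)
    exact h.comp_ofReal.hasDerivWithinAt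
  · intro u hu
    exact hDt u (by linarith [hu.1]) hu.2.le

lemma tsum_primes_log_mul_rpow_le {σ : ℝ} (hσ : 1 < σ) :
    Summable (fun p : Nat.Primes => Real.log p * (p : ℝ) ^ (-σ)) ∧
      ∑' p : Nat.Primes, Real.log p * (p : ℝ) ^ (-σ)
        ≤ ‖deriv riemannZeta σ / riemannZeta σ‖ := by
  have h := (norm_logDeriv_riemannZeta_le_re (s := σ) (by simpa using hσ)).1
  rw [ofReal_re] at h
  have hinj : Function.Injective (fun p : Nat.Primes => (p : ℕ)) := Subtype.val_injective
  have hterm : ∀ p : Nat.Primes, Real.log p * (p : ℝ) ^ (-σ) =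
      ‖LSeries.term (fun n => ((ArithmeticFunction.vonMangoldt n : ℝ) : ℂ)) σ p‖ := by
    intro p
    rw [LSeries.norm_term_eq, if_neg p.2.ne_zero, ArithmeticFunction.vonMangoldt_apply_prime p.2,
      norm_real, Real.norm_eq_abs, abs_of_nonneg (Real.log_natCast_nonneg _), ofReal_re,
      Real.rpow_neg (by positivity), div_eq_mul_inv]
  have hs : Summable (fun p : Nat.Primes => Real.log p * (p : ℝ) ^ (-σ)) :=
    (h.summable.comp_injective hinj).congr fun p => (hterm p).symm
  refine ⟨hs, ?_⟩
  rw [← h.tsum_eq, tsum_congr hterm]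
  exact tsum_comp_le_tsum_of_inj h.summable (fun n => norm_nonneg _) hinj

lemma re_natCast_cpow_neg {p : ℕ} (hp : 0 < p) (σ t : ℝ) :
    ((p : ℂ) ^ (-(σ + t * I))).re = Real.cos (t * Real.log p) * (p : ℝ) ^ (-σ) := by
  have h : (p : ℂ) ^ (-(σ + t * I)) =
      exp (((-σ * Real.log p : ℝ) : ℂ) + ((-(t * Real.log p) : ℝ) : ℂ) * I) := by
    rw [cpow_def_of_ne_zero (by exact_mod_cast hp.ne'), ← natCast_log]
    congr 1
    push_cast
    ring
  rw [h, exp_re, Real.rpow_def_of_pos (by exact_mod_cast hp)]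
  rw [add_re, add_im, re_ofReal_mul, im_ofReal_mul, I_re, I_im, ofReal_re, ofReal_im, mul_zero,
    mul_one, add_zero, zero_add, Real.cos_neg, mul_comm, mul_comm (Real.log p), mul_comm t]

lemma re_natCast_cpow_neg_le {p : ℕ} (hp : p.Prime) {s : ℂ} (hs : 1 ≤ s.re) :
    ((p : ℂ) ^ (-s)).re ≤ (-log (1 - (p : ℂ) ^ (-s))).re + (p : ℝ) ^ (-2 : ℝ) := by
  have hp2 : (2 : ℝ) ≤ p := by exact_mod_cast hp.two_le
  set z := (p : ℂ) ^ (-s) with hz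
  have hzn : ‖z‖ ≤ (p : ℝ)⁻¹ := by
    rw [hz, norm_natCast_cpow_of_pos hp.pos, neg_re, ← Real.rpow_neg_one]
    exact Real.rpow_le_rpow_of_exponent_le (by linarith) (by linarith)
  have hpi : (p : ℝ)⁻¹ ≤ 1 / 2 := by
    rw [one_div]
    gcongr
  have hz1 : ‖z‖ ≤ 1 / 2 := hzn.trans hpi
  have h1 := norm_log_one_add_sub_self_le (z := -z) (by rw [norm_neg]; linarith)
  rw [norm_neg] at h1
  have h2 : (1 - ‖z‖)⁻¹ ≤ 2 := by
    rw [inv_le_comm₀ (by linarith) (by norm_num)]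
    linarith
  have h3 : ‖log (1 + -z) - -z‖ ≤ (p : ℝ) ^ (-2 : ℝ) := by
    have h4 : (p : ℝ) ^ (-2 : ℝ) = (p : ℝ)⁻¹ ^ 2 := by
      rw [Real.rpow_neg (by positivity), Real.rpow_two, inv_pow]
    rw [h4]
    calc _ ≤ ‖z‖ ^ 2 * (1 - ‖z‖)⁻¹ / 2 := h1
      _ ≤ ‖z‖ ^ 2 * 2 / 2 := by gcongr
      _ = ‖z‖ ^ 2 := by ring
      _ ≤ _ := by gcongr
  have h5 := (re_le_norm _).trans h3
  rw [← sub_eq_add_neg, sub_neg_eq_add, add_re] at h5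
  rw [neg_re]
  linarith

lemma ite_cos_div_le {p : ℕ} (hp : p.Prime) {x κ σ : ℝ} (t : ℝ) (hx : 1 < x)
    (hκ : κ = (Real.log x)⁻¹) (hσ : σ = 1 + κ) :
    (if (p : ℝ) ≤ x then Real.cos (t * Real.log p) / p else 0)
      ≤ Real.cos (t * Real.log p) * (p : ℝ) ^ (-σ) +
        Real.exp 1 * κ * (Real.log p * (p : ℝ) ^ (-σ)) := by
  have hp0 : (0 : ℝ) < p := by exact_mod_cast hp.pos
  have hlogx : 0 < Real.log x := Real.log_pos hx
  have hlogp : 0 ≤ Real.log p := Real.log_natCast_nonneg p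
  set P := (p : ℝ) ^ (-σ) with hP
  have hP0 : 0 < P := by positivity
  set y := κ * Real.log p with hy
  have hy0 : 0 ≤ y := by rw [hy, hκ]; positivity
  have hpinv : (p : ℝ)⁻¹ = P * Real.exp y := by
    rw [hP, Real.rpow_def_of_pos hp0, ← Real.exp_add, hy, hσ,
      show Real.log p * -(1 + κ) + κ * Real.log p = -Real.log p by ring, Real.exp_neg,
      Real.exp_log hp0]
  have hc1 := Real.cos_le_one (t * Real.log p)
  have hc2 := Real.neg_one_le_cos (t * Real.log p)
  have he : 1 ≤ Real.exp 1 := Real.one_le_exp (by norm_num)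
  rw [show Real.exp 1 * κ * (Real.log p * P) = P * (Real.exp 1 * y) by rw [hy]; ring]
  split_ifs with h
  · have hy1 : y ≤ 1 := by
      rw [hy, hκ, inv_mul_le_iff₀ hlogx, mul_one]
      exact Real.log_le_log hp0 h
    have h1 : 1 ≤ Real.exp y := Real.one_le_exp hy0
    have h2 : Real.exp y - 1 ≤ Real.exp 1 * y := by
      have h3 : Real.exp y * (1 - y) ≤ 1 := by
        have h4 : Real.exp y * (1 - y) ≤ Real.exp y * Real.exp (-y) := by
          gcongr
          exact Real.one_sub_le_exp_neg y
        rwa [← Real.exp_add, add_neg_cancel, Real.exp_zero] at h4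
      have h5 : Real.exp y * y ≤ Real.exp 1 * y := by gcongr
      linarith
    rw [div_eq_mul_inv, hpinv]
    have h6 : Real.cos (t * Real.log p) * (Real.exp y - 1) ≤ Real.exp y - 1 :=
      mul_le_of_le_one_left (by linarith) hc1
    nlinarith
  · have hy1 : 1 ≤ y := by
      rw [hy, hκ, inv_mul_eq_div, one_le_div hlogx]
      exact Real.log_le_log (by linarith) (not_le.1 h).le
    nlinarith [mul_le_mul he hy1 zero_le_one (by linarith)]

lemma summable_primes_neg_log {s : ℂ} (hs : 1 < s.re) :
    Summable fun p : Nat.Primes => -log (1 - (p : ℂ) ^ (-s)) := by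
  have h := DirichletCharacter.summable_neg_log_one_sub_mul_prime_cpow
    (1 : DirichletCharacter ℂ 1) hs
  simpa [MulChar.one_apply (isUnit_of_subsingleton _)] using h

lemma tsum_primes_re_neg_log {s : ℂ} (hs : 1 < s.re) :
    ∑' p : Nat.Primes, (-log (1 - (p : ℂ) ^ (-s))).re = Real.log ‖riemannZeta s‖ := by
  rw [← riemannZeta_eulerProduct_exp_log hs, norm_exp, Real.log_exp,
    re_tsum (summable_primes_neg_log hs)]

lemma sum_primes_cos_div_le {x κ σ : ℝ} (t : ℝ) (hx : 1 < x) (hκ : κ = (Real.log x)⁻¹)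
    (hσ : σ = 1 + κ) :
    ∑ p ∈ (Finset.Iic ⌊x⌋₊).filter Nat.Prime, Real.cos (t * Real.log p) / p
      ≤ Real.log ‖riemannZeta (σ + t * I)‖ + ∑' p : Nat.Primes, (p : ℝ) ^ (-2 : ℝ) +
        Real.exp 1 * κ * ‖deriv riemannZeta σ / riemannZeta σ‖ := by
  have hκ0 : 0 < κ := by
    rw [hκ]
    exact inv_pos.2 (Real.log_pos hx)
  have hσ1 : 1 < σ := by linarith
  set s : ℂ := σ + t * I with hs
  have hsre : s.re = σ := by simp [hs]
  have hs1 : 1 < s.re := by rwa [hsre]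
  set T : Finset Nat.Primes := (Finset.Iic ⌊x⌋₊).subtype Nat.Prime
  have hleft : HasSum (fun p : Nat.Primes =>
      if (p : ℝ) ≤ x then Real.cos (t * Real.log p) / p else 0)
      (∑ p ∈ (Finset.Iic ⌊x⌋₊).filter Nat.Prime, Real.cos (t * Real.log p) / p) := by
    have hmem : ∀ p : Nat.Primes, p ∈ T ↔ (p : ℝ) ≤ x := fun p =>
      Finset.mem_subtype.trans (by rw [Finset.mem_Iic, Nat.le_floor_iff (by linarith)])
    rw [← Finset.sum_subtype_eq_sum_filter]
    have h1 := hasSum_sum_of_ne_finset_zero (L := .unconditional _) (s := T)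
      (f := fun p : Nat.Primes => if (p : ℝ) ≤ x then Real.cos (t * Real.log p) / p else 0)
      (fun p hp => if_neg fun h => hp ((hmem p).2 h))
    rwa [Finset.sum_congr rfl fun p hp => if_pos ((hmem p).1 hp)] at h1
  have hlog := tsum_primes_log_mul_rpow_le hσ1
  have hright := (((hasSum_re (summable_primes_neg_log hs1).hasSum).add
    (Nat.Primes.summable_rpow.2 (show (-2 : ℝ) < -1 by norm_num)).hasSum).add
    (hlog.1.hasSum.mul_left (Real.exp 1 * κ)))
  rw [re_tsum (summable_primes_neg_log hs1), tsum_primes_re_neg_log hs1] at hright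
  refine (hasSum_le (fun p => ?_) hleft hright).trans ?_
  · refine (ite_cos_div_le p.2 t hx hκ hσ).trans ?_
    gcongr
    rw [← re_natCast_cpow_neg p.2.pos]
    exact re_natCast_cpow_neg_le p.2 hs1.le
  · gcongr
    exact hlog.2

/-- Under the Riemann hypothesis, for `x ≥ e^{2e}` and `10 ≤ α ≤ e^x`,
`∑_{p ≤ x} cos(α log p)/p ≤ log log log α + O(1)`. -/
theorem stmt_3
    (RH : ∀ s : ℂ, riemannZeta s = 0 → 0 < s.re → s.re < 1 → s.re = 1 / 2) :
    ∃ C : ℝ, 0 < C ∧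
      ∀ x : ℝ, Real.exp (2 * Real.exp 1) ≤ x →
        ∀ α : ℝ, 10 ≤ α → α ≤ Real.exp x →
          (∑ p ∈ (Finset.Iic ⌊x⌋₊).filter Nat.Prime, Real.cos (α * Real.log p) / p)
            ≤ Real.log (Real.log (Real.log α)) + C := by
  have hz : ∀ s : ℂ, 1 / 2 < s.re → riemannZeta s ≠ 0 := by
    intro s hs h0
    rcases lt_or_ge s.re 1 with h1 | h1
    · linarith [RH s h0 (by linarith) h1]
    · exact riemannZeta_ne_zero_of_one_le_re h1 h0
  obtain ⟨A, hA, hAb⟩ := exists_riemannZeta_bounds_near_one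
  obtain ⟨C, hC, hCb⟩ := exists_norm_riemannZeta_le_log_log hz
  set S := ∑' p : Nat.Primes, (p : ℝ) ^ (-2 : ℝ)
  have hS0 : 0 ≤ S := tsum_nonneg fun p => by positivity
  refine ⟨|Real.log C| + S + Real.exp 1 * A, by positivity, fun x hx α hα hαx => ?_⟩
  have hL := two_thirds_le_log_log hα
  have hlogx : 2 ≤ Real.log x := by
    have h1 := Real.log_le_log (Real.exp_pos _) hx
    rw [Real.log_exp] at h1
    linarith [Real.one_le_exp (zero_le_one (α := ℝ))]
  have hx0 : 0 < x := (Real.exp_pos _).trans_le hx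
  have hx1 : 1 < x := by
    rw [← Real.log_pos_iff hx0.le]
    linarith
  have hlogα : Real.log α ≤ x := (Real.log_le_iff_le_exp (by linarith)).2 hαx
  have hlogα0 : 0 < Real.log α := Real.log_pos (by linarith)
  have hLx : Real.log (Real.log α) ≤ Real.log x := Real.log_le_log hlogα0 hlogα
  have hκ0 : 0 < (Real.log x)⁻¹ := inv_pos.2 (by linarith)
  have hκ1 : (Real.log x)⁻¹ ≤ 9 := (inv_le_comm₀ (by linarith) (by norm_num)).2 (by linarith)
  have hκL : (Real.log x)⁻¹ ≤ (Real.log (Real.log α))⁻¹ := by gcongr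
  refine (sum_primes_cos_div_le α hx1 rfl rfl).trans ?_
  have h1 := hCb α hα (1 + (Real.log x)⁻¹) (by linarith) (by linarith)
  have hne : riemannZeta (((1 + (Real.log x)⁻¹ : ℝ) : ℂ) + α * I) ≠ 0 := by
    refine hz _ ?_
    rw [add_re, ofReal_re, re_ofReal_mul, I_re]
    linarith
  have h2 := Real.log_le_log (norm_pos_iff.2 hne) h1
  rw [Real.log_mul hC.ne' (by linarith)] at h2
  have h3 : Real.exp 1 * (Real.log x)⁻¹ *
      ‖deriv riemannZeta ((1 + (Real.log x)⁻¹ : ℝ) : ℂ) /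
        riemannZeta ((1 + (Real.log x)⁻¹ : ℝ) : ℂ)‖ ≤ Real.exp 1 * A := by
    rw [mul_assoc]
    gcongr
    have := (hAb _ hκ0 hκ1).1
    rwa [le_div_iff₀ hκ0, mul_comm] at this
  linarith [le_abs_self (Real.log C)]
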